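/- (High values.) For every integer d ≥ 3, every integer n in the interval [[d-3]₄, [d-1]₄ + 1] belongs to T(d) := ∪_{i=0}^{d-1} T(d,i); that is, PG_d(4) admits a legal truncation removing n points leaving some hyperplane whose removed points form exactly a copy of PG_i(4) for some i. -/

import Mathlib

/-- The field with four elements. -/
abbrev F4 : Type := GaloisField 2 2

/-- The points of the projective space `PG_d(4)` : one-dimensional subspaces of `F4^(d+1)`. -/
abbrev PGPoint (d : ℕ) := Projectivization F4 (Fin (d + 1) → F4)

/-- The set of projective points lying in a given linear subspace `W` of `F4^(d+1)`. -/
def pointsIn {d : ℕ} (W : Submodule F4 (Fin (d + 1) → F4)) : Set (PGPoint d) :=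
  {p | p.submodule ≤ W}

/-- A line of `PG_d(4)` : the set of points contained in some 2-dimensional linear subspace. -/
def IsLine {d : ℕ} (L : Set (PGPoint d)) : Prop :=
  ∃ W : Submodule F4 (Fin (d + 1) → F4), Module.finrank F4 W = 2 ∧ L = pointsIn W

/-- `LegalTrunc D` : removing the point set `D` from `PG_d(4)` is a legal truncation,
i.e. no line has exactly two points outside `D`. -/
def LegalTrunc {d : ℕ} (D : Set (PGPoint d)) : Prop :=
  ∀ L : Set (PGPoint d), IsLine L → (L \ D).ncard ≠ 2

/-- `bracket4 e = [e]₄ = 1 + 4 + 4² + ⋯ + 4^e`. -/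
def bracket4 (e : ℕ) : ℕ := ∑ i ∈ Finset.range (e + 1), 4 ^ i

/-- `TT d i` (the set `T(d,i)` of the paper): the set of integers `n` such that `PG_d(4)`
admits a legal truncation removing `n` points, in which some hyperplane `H` has
removed-point set exactly the point set of a copy of `PG_i(4)` contained in `H`. -/
def TT (d i : ℕ) : Set ℕ :=
  {n | ∃ D : Set (PGPoint d), LegalTrunc D ∧ D.ncard = n ∧
    ∃ H W : Submodule F4 (Fin (d + 1) → F4),
      Module.finrank F4 H = d ∧ Module.finrank F4 W = i + 1 ∧ W ≤ H ∧
        D ∩ pointsIn H = pointsIn W}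

/-- `SS d i = S(d,i) = T(d,i) - [i]₄` (every element of `T(d,i)` is at least `[i]₄`). -/
def SS (d i : ℕ) : Set ℕ := {m | m + bracket4 i ∈ TT d i}

open Projectivization

/-! ### The field with four elements -/

theorem natCard_F4 : Nat.card F4 = 4 := by
  rw [GaloisField.card 2 2 two_ne_zero]; norm_num

instance finite_F4 : Finite F4 := Nat.finite_of_card_ne_zero (by rw [natCard_F4]; norm_num)

theorem F4.two_eq_zero : (2 : F4) = 0 := CharTwo.two_eq_zero

theorem F4.pow_four (x : F4) : x ^ 4 = x := by
  have := Fintype.ofFinite F4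
  have h := FiniteField.pow_card x
  rwa [← Nat.card_eq_fintype_card, natCard_F4] at h

/-- A primitive cube root of unity exists in `F4`. -/
theorem F4.exists_cubeRoot : ∃ ω : F4, ω ^ 2 + ω + 1 = 0 := by
  obtain ⟨x, hx⟩ : ∃ x : F4, x ∉ ({0, 1} : Set F4) := by
    by_contra! h
    have h1 : ({0, 1} : Set F4) = Set.univ := Set.eq_univ_of_forall h
    have h2 := Set.ncard_pair (zero_ne_one (α := F4))
    rw [h1, Set.ncard_univ, natCard_F4] at h2
    omega
  simp only [Set.mem_insert_iff, Set.mem_singleton_iff, not_or] at hx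
  refine ⟨x, ?_⟩
  have h : x * (x - 1) * (x ^ 2 + x + 1) = 0 := by linear_combination F4.pow_four x
  simpa [hx.1, sub_eq_zero, hx.2] using h

/-! ### A hyperoval in the affine plane -/

/-- The nucleus and the five points of the conic `x² + xy + ωy² = 1`. -/
noncomputable def hyperoval (ω : F4) : Fin 6 → F4 × F4 :=
  ![(0, 0), (1, 0), (0, ω), (ω, ω), (1, ω ^ 2), (ω, ω ^ 2)]

section Hyperoval

variable {ω : F4}

theorem anisotropic (hω : ω ^ 2 + ω + 1 = 0) {x y : F4} (h : x ^ 2 + x * y + ω * y ^ 2 = 0) :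
    x = 0 ∧ y = 0 := by
  have h2 := F4.two_eq_zero
  have hy : y = 0 := by
    by_contra hy
    obtain ⟨z, rfl⟩ : ∃ z, x = z * y := ⟨x / y, by field_simp⟩
    have hz : z ^ 2 + z + ω = 0 := by
      have : (z ^ 2 + z + ω) * y ^ 2 = 0 := by linear_combination h
      simpa [hy] using this
    have h4 := F4.pow_four z
    have : (1 : F4) = 0 := by grind
    exact one_ne_zero this
  subst hy
  simpa using h

theorem hyperoval_mem (hω : ω ^ 2 + ω + 1 = 0) (i : Fin 6) :
    hyperoval ω i = 0 ∨
      (hyperoval ω i).1 ^ 2 + (hyperoval ω i).1 * (hyperoval ω i).2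
        + ω * (hyperoval ω i).2 ^ 2 = 1 := by
  have h2 := F4.two_eq_zero
  fin_cases i
  · left; simp [hyperoval]
  all_goals right; simp [hyperoval]; try grind

theorem hyperoval_injective (hω : ω ^ 2 + ω + 1 = 0) : Function.Injective (hyperoval ω) := by
  have h0 : ω ≠ 0 := by rintro rfl; simp at hω
  have h1 : ω ≠ 1 := by rintro rfl; have h2 := F4.two_eq_zero; grind
  intro i j h
  fin_cases i <;> fin_cases j <;> simp [hyperoval, h0, h1, h0.symm, h1.symm, pow_two] at h ⊢

theorem hyperoval_collinear (hω : ω ^ 2 + ω + 1 = 0) {i j k : Fin 6}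
    (h : hyperoval ω k = ω • hyperoval ω i + ω ^ 2 • hyperoval ω j) :
    hyperoval ω i = hyperoval ω j := by
  have h2 := F4.two_eq_zero
  have h0 : ω ≠ 0 := by rintro rfl; simp at hω
  have h1 : ω ≠ 1 := by rintro rfl; grind
  have hi := hyperoval_mem hω i
  have hj := hyperoval_mem hω j
  have hk := hyperoval_mem hω k
  rw [h] at hk
  generalize hyperoval ω i = p at *
  generalize hyperoval ω j = r at *
  obtain ⟨a, b⟩ := p
  obtain ⟨c, d⟩ := r
  simp only [Prod.smul_mk, smul_eq_mul, Prod.mk_add_mk, Prod.mk_eq_zero, Prod.mk.injEq] at *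
  rcases hi with ⟨rfl, rfl⟩ | hi
  · rcases hj with ⟨rfl, rfl⟩ | hj
    · simp
    · exfalso
      rcases hk with hk | hk
      · simp_all
      · exact h1 (by grind)
  rcases hj with ⟨rfl, rfl⟩ | hj
  · exfalso
    rcases hk with hk | hk
    · simp_all
    · exact h1 (by grind)
  rcases hk with ⟨hk1, hk2⟩ | hk
  · exfalso
    have ha : a = ω * c := by grind
    have hb : b = ω * d := by grind
    exact h1 (by grind)
  · have := anisotropic hω (x := a + c) (y := b + d) (by grind)
    grind

end Hyperoval

/-! ### Affine sets without 2-secants -/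

/-- No affine line over `F4` has exactly two points outside `A`; as the lines have four points,
equivalently none has exactly two points in `A`. -/
def NoTwoSecant (ω : F4) {m : ℕ} (A : Set (Fin m → F4)) : Prop :=
  ∀ x y, ω • x + ω ^ 2 • y ∈ A → ω ^ 2 • x + ω • y ∈ A → x ∈ A ∨ y ∈ A

/-- The copy of `A` in the hyperplane `x 0 = 0`. -/
def lift0 {m : ℕ} (A : Set (Fin m → F4)) : Set (Fin (m + 1) → F4) :=
  {x | x 0 = 0 ∧ Fin.tail x ∈ A}

section NoTwoSecant

variable {ω : F4} {m : ℕ} {A : Set (Fin m → F4)}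

theorem NoTwoSecant.compl (hω : ω ^ 2 + ω + 1 = 0) (hA : NoTwoSecant ω A) :
    NoTwoSecant ω Aᶜ := by
  have h2 := F4.two_eq_zero
  intro x y h3 h4
  by_contra! h
  simp only [Set.mem_compl_iff, not_not] at h h3 h4
  rcases hA (ω • x + ω ^ 2 • y) (ω ^ 2 • x + ω • y)
    (by convert h.1 using 1; ext i; simp; grind)
    (by convert h.2 using 1; ext i; simp; grind) with h5 | h5
  · exact h3 h5
  · exact h4 h5

theorem NoTwoSecant.lift0 (hω : ω ^ 2 + ω + 1 = 0) (hA : NoTwoSecant ω A) :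
    NoTwoSecant ω (lift0 A) := by
  have h2 := F4.two_eq_zero
  rintro x y ⟨h3, h4⟩ ⟨h5, h6⟩
  simp only [Pi.add_apply, Pi.smul_apply, smul_eq_mul] at h3 h5
  have hx : x 0 = 0 := by grind
  have hy : y 0 = 0 := by grind
  exact (hA (Fin.tail x) (Fin.tail y) h4 h6).imp (⟨hx, ·⟩) (⟨hy, ·⟩)

theorem ncard_lift0 (A : Set (Fin m → F4)) : (lift0 A).ncard = A.ncard := by
  have h : lift0 A = Fin.cons (α := fun _ => F4) 0 '' A := by
    ext x
    constructor
    · rintro ⟨h1, h2⟩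
      exact ⟨_, h2, by rw [← h1, Fin.cons_self_tail]⟩
    · rintro ⟨y, hy, rfl⟩
      exact ⟨by simp, by simpa using hy⟩
  rw [h, Set.ncard_image_of_injective _ (Fin.cons_right_injective _)]

theorem ncard_add_ncard_compl_F4 (A : Set (Fin m → F4)) : A.ncard + Aᶜ.ncard = 4 ^ m := by
  rw [Set.ncard_add_ncard_compl, Nat.card_fun, natCard_F4, Nat.card_fin]

theorem ncard_compl_lift0_compl (A : Set (Fin m → F4)) :
    (lift0 Aᶜ)ᶜ.ncard = A.ncard + 3 * 4 ^ m := by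
  have h1 := ncard_add_ncard_compl_F4 A
  have h2 := ncard_add_ncard_compl_F4 (lift0 Aᶜ)
  rw [ncard_lift0, pow_succ] at h2
  omega

theorem sum_ite_lt {k c : ℕ} (hk : k ≤ 6) :
    ∑ j : Fin 6, (if (j : ℕ) < k then c else 0) = k * c := by
  interval_cases k <;> simp [Fin.sum_univ_succ] <;> ring

/-- Every number up to `6 · 4^m` is a sum of six sizes of sets without 2-secants. -/
theorem exists_six_noTwoSecant (hω : ω ^ 2 + ω + 1 = 0) (m N : ℕ) (hN : N ≤ 6 * 4 ^ m) :
    ∃ a : Fin 6 → Set (Fin m → F4),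
      (∀ j, NoTwoSecant ω (a j)) ∧ ∑ j, (a j).ncard = N := by
  induction m generalizing N with
  | zero =>
    refine ⟨fun j => if (j : ℕ) < N then Set.univ else ∅, fun j => ?_, ?_⟩
    · dsimp only
      split_ifs
      · exact fun _ _ _ _ => .inl trivial
      · exact fun _ _ h _ => h.elim
    · have h := sum_ite_lt (k := N) (c := 1) (by simpa using hN)
      rw [mul_one] at h
      refine Eq.trans (Finset.sum_congr rfl fun j _ => ?_) h
      dsimp only
      split_ifs
      · rw [Set.ncard_univ, Nat.card_unique]
      · exact Set.ncard_empty _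
  | succ m ih =>
    obtain ⟨k, r, hk, hr, rfl⟩ : ∃ k r, k ≤ 6 ∧ r ≤ 6 * 4 ^ m ∧ N = r + k * (3 * 4 ^ m) := by
      rw [pow_succ] at hN
      generalize 4 ^ m = t at *
      by_cases h0 : N ≤ 6 * t
      · exact ⟨0, N, by omega, h0, by omega⟩
      by_cases h1 : N ≤ 12 * t
      · exact ⟨2, N - 6 * t, by omega, by omega, by omega⟩
      by_cases h2 : N ≤ 18 * t
      · exact ⟨4, N - 12 * t, by omega, by omega, by omega⟩
      · exact ⟨6, N - 18 * t, by omega, by omega, by omega⟩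
    obtain ⟨a, ha, hs⟩ := ih r hr
    refine ⟨fun j => if (j : ℕ) < k then (lift0 (a j)ᶜ)ᶜ else lift0 (a j),
      fun j => ?_, ?_⟩
    · dsimp only
      split_ifs
      · exact (((ha j).compl hω).lift0 hω).compl hω
      · exact (ha j).lift0 hω
    · rw [← hs, ← sum_ite_lt hk, ← Finset.sum_add_distrib]
      refine Finset.sum_congr rfl fun j _ => ?_
      dsimp only
      split_ifs
      · exact ncard_compl_lift0_compl _
      · exact ncard_lift0 _

end NoTwoSecant

/-! ### Point sets given by a subspace at infinity and an affine part -/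

section Truncation

variable {d : ℕ}

/-- The points of `W` together with the affine points `[w]`, `w ∈ A`. -/
def truncSet (W : Submodule F4 (Fin (d + 1) → F4)) (A : Set (Fin (d + 1) → F4)) :
    Set (PGPoint d) :=
  pointsIn W ∪ {p | ∃ (w : Fin (d + 1) → F4) (hw : w ≠ 0), w ∈ A ∧ p = mk F4 w hw}

variable {W : Submodule F4 (Fin (d + 1) → F4)} {A : Set (Fin (d + 1) → F4)}

theorem mk_mem_pointsIn (w : Fin (d + 1) → F4) (hw : w ≠ 0) :
    mk F4 w hw ∈ pointsIn W ↔ w ∈ W := by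
  simp [pointsIn, submodule_mk]

theorem eq_of_mk_eq_mk {u v : Fin (d + 1) → F4} {hu : u ≠ 0} {hv : v ≠ 0}
    (h : mk F4 u hu = mk F4 v hv) (h1 : u 0 = 1) (h2 : v 0 = 1) : u = v := by
  obtain ⟨c, rfl⟩ := (mk_eq_mk_iff' F4 u v hu hv).1 h
  have : c = 1 := by simpa [h2] using h1
  simp [this]

theorem mk_mem_truncSet_of_zero (hA : ∀ w ∈ A, w 0 = 1) {w : Fin (d + 1) → F4} {hw : w ≠ 0}
    (h0 : w 0 = 0) : mk F4 w hw ∈ truncSet W A ↔ w ∈ W := by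
  rw [truncSet, Set.mem_union, mk_mem_pointsIn]
  refine or_iff_left ?_
  rintro ⟨v, hv, hvA, h⟩
  obtain ⟨c, rfl⟩ := (mk_eq_mk_iff' F4 v w hv hw).1 h.symm
  simpa [h0] using hA _ hvA

theorem mk_mem_truncSet_of_one (hW : ∀ w ∈ W, w 0 = 0) (hA : ∀ w ∈ A, w 0 = 1)
    {w : Fin (d + 1) → F4} {hw : w ≠ 0} (h1 : w 0 = 1) :
    mk F4 w hw ∈ truncSet W A ↔ w ∈ A := by
  rw [truncSet, Set.mem_union, mk_mem_pointsIn]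
  constructor
  · rintro (h | ⟨v, hv, hvA, h⟩)
    · exact absurd (h1.symm.trans (hW w h)) one_ne_zero
    · rwa [eq_of_mk_eq_mk h h1 (hA v hvA)]
  · exact fun h => .inr ⟨w, hw, h, rfl⟩

theorem exists_normalized_rep (p : PGPoint d) :
    ∃ (u : Fin (d + 1) → F4) (hu : u ≠ 0), p = mk F4 u hu ∧ (u 0 = 0 ∨ u 0 = 1) := by
  by_cases h : p.rep 0 = 0
  · exact ⟨p.rep, p.rep_nonzero, p.mk_rep.symm, .inl h⟩
  · refine ⟨(p.rep 0)⁻¹ • p.rep, smul_ne_zero (inv_ne_zero h) p.rep_nonzero, ?_,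
      .inr (by simp [h])⟩
    conv_lhs => rw [← p.mk_rep]
    rw [mk_eq_mk_iff']
    exact ⟨p.rep 0, by rw [smul_smul, mul_inv_cancel₀ h, one_smul]⟩

/-- A criterion for `truncSet W A` to be a legal truncation: `hsec` concerns the lines meeting the
hyperplane at infinity outside `W`, `hcyl` those meeting it in `W`. -/
theorem legalTrunc_truncSet {ω : F4} (hω : ω ^ 2 + ω + 1 = 0)
    (hW : ∀ w ∈ W, w 0 = 0) (hA : ∀ w ∈ A, w 0 = 1)
    (hsec : ∀ u v : Fin (d + 1) → F4, u 0 = 1 → v 0 = 0 →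
      u + v ∈ A → u + ω • v ∈ A → u + ω ^ 2 • v ∈ A → v ∈ W)
    (hcyl : ∀ u v : Fin (d + 1) → F4, u 0 = 1 → v 0 = 1 → u + v ∈ W →
      ω • u + ω ^ 2 • v ∈ A → ω ^ 2 • u + ω • v ∈ A → u ∈ A ∨ v ∈ A) :
    LegalTrunc (truncSet W A) := by
  have h2 := F4.two_eq_zero
  have hω0 : ω ≠ 0 := by rintro rfl; simp at hω
  rintro L ⟨U, -, rfl⟩ hL
  obtain ⟨p, q, hpq, hs⟩ := Set.ncard_eq_two.1 hL
  have hp : p ∈ pointsIn U \ truncSet W A := hs ▸ Set.mem_insert _ _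
  have hq : q ∈ pointsIn U \ truncSet W A := hs ▸ Set.mem_insert_of_mem _ rfl
  obtain ⟨u, hu, rfl, hu01⟩ := exists_normalized_rep p
  obtain ⟨v, hv, rfl, hv01⟩ := exists_normalized_rep q
  rw [Set.mem_sdiff, mk_mem_pointsIn] at hp hq
  have key : ∀ a b : F4, a ≠ 0 → b ≠ 0 →
      ∃ h : a • u + b • v ≠ 0, mk F4 (a • u + b • v) h ∈ truncSet W A := by
    intro a b ha hb
    have h : a • u + b • v ≠ 0 := by
      intro h
      apply hpq
      rw [mk_eq_mk_iff']
      refine ⟨-(a⁻¹ * b), ?_⟩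
      rw [← inv_smul_smul₀ ha u, eq_neg_of_add_eq_zero_left h]
      simp [smul_smul]
    refine ⟨h, ?_⟩
    by_contra hD
    have hmem : mk F4 _ h ∈ pointsIn U \ truncSet W A :=
      ⟨(mk_mem_pointsIn _ h).2
        (U.add_mem (U.smul_mem a hp.1) (U.smul_mem b hq.1)), hD⟩
    rw [hs] at hmem
    rcases hmem with hmem | hmem
    · obtain ⟨c, hc⟩ := (mk_eq_mk_iff' F4 _ _ _ _).1 hmem
      apply hpq
      rw [eq_comm, mk_eq_mk_iff']
      refine ⟨b⁻¹ * (c - a), ?_⟩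
      rw [mul_smul, sub_smul, hc, add_sub_cancel_left, inv_smul_smul₀ hb]
    · obtain ⟨c, hc⟩ := (mk_eq_mk_iff' F4 _ _ _ _).1 hmem
      apply hpq
      rw [mk_eq_mk_iff']
      refine ⟨a⁻¹ * (c - b), ?_⟩
      rw [mul_smul, sub_smul, hc, add_sub_cancel_right, inv_smul_smul₀ ha]
  have key' : ∀ a b : F4, a ≠ 0 → b ≠ 0 →
      ((a • u + b • v) 0 = 0 → a • u + b • v ∈ W) ∧
      ((a • u + b • v) 0 = 1 → a • u + b • v ∈ A) := by
    intro a b ha hb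
    obtain ⟨h, hD⟩ := key a b ha hb
    exact ⟨fun h0 => (mk_mem_truncSet_of_zero hA h0).1 hD,
      fun h1 => (mk_mem_truncSet_of_one hW hA h1).1 hD⟩
  have hω2 : ω ^ 2 ≠ 0 := pow_ne_zero 2 hω0
  have k11 := key' 1 1 one_ne_zero one_ne_zero
  have k1ω := key' 1 ω one_ne_zero hω0
  have k1ω2 := key' 1 (ω ^ 2) one_ne_zero hω2
  have kω1 := key' ω 1 hω0 one_ne_zero
  have kω21 := key' (ω ^ 2) 1 hω2 one_ne_zero
  have kωω2 := key' ω (ω ^ 2) hω0 hω2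
  have kω2ω := key' (ω ^ 2) ω hω2 hω0
  simp only [one_smul, Pi.add_apply, Pi.smul_apply, smul_eq_mul]
    at k11 k1ω k1ω2 kω1 kω21 kωω2 kω2ω
  rcases hu01 with hu0 | hu1 <;> rcases hv01 with hv0 | hv1
  · refine hp.2 ((mk_mem_truncSet_of_zero hA hu0).2 ?_)
    have := W.add_mem (k11.1 (by simp [hu0, hv0])) (kω1.1 (by simp [hu0, hv0]))
    rw [← W.smul_mem_iff hω2]
    convert this using 1
    ext i
    simp
    grind
  · refine hp.2 ((mk_mem_truncSet_of_zero hA hu0).2 (hsec v u hv1 hu0 ?_ ?_ ?_))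
    · rw [add_comm v]; exact k11.2 (by simp [hu0, hv1])
    · rw [add_comm v]; exact kω1.2 (by simp [hu0, hv1])
    · rw [add_comm v]; exact kω21.2 (by simp [hu0, hv1])
  · refine hq.2 ((mk_mem_truncSet_of_zero hA hv0).2 (hsec u v hu1 hv0 ?_ ?_ ?_))
    · exact k11.2 (by simp [hv0, hu1])
    · exact k1ω.2 (by simp [hv0, hu1])
    · exact k1ω2.2 (by simp [hv0, hu1])
  · rcases hcyl u v hu1 hv1 (k11.1 (by grind)) (kωω2.2 (by grind)) (kω2ω.2 (by grind)) with h | h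
    · exact hp.2 ((mk_mem_truncSet_of_one hW hA hu1).2 h)
    · exact hq.2 ((mk_mem_truncSet_of_one hW hA hv1).2 h)

theorem truncSet_inter_pointsIn {H : Submodule F4 (Fin (d + 1) → F4)}
    (hH : ∀ w, w ∈ H ↔ w 0 = 0) (hW : W ≤ H) (hA : ∀ w ∈ A, w 0 = 1) :
    truncSet W A ∩ pointsIn H = pointsIn W := by
  ext p
  induction p using Projectivization.ind with
  | h w hw =>
    rw [Set.mem_inter_iff, mk_mem_pointsIn, mk_mem_pointsIn, hH]
    constructor
    · rintro ⟨h, h0⟩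
      exact (mk_mem_truncSet_of_zero hA h0).1 h
    · intro h
      have h0 := (hH w).1 (hW h)
      exact ⟨(mk_mem_truncSet_of_zero hA h0).2 h, h0⟩

theorem ncard_pointsIn {i : ℕ} (h : Module.finrank F4 W = i + 1) :
    (pointsIn W).ncard = bracket4 i := by
  have hr : pointsIn W = Set.range (Projectivization.map W.subtype W.injective_subtype) := by
    ext p
    induction p using Projectivization.ind with
    | h w hw =>
      rw [mk_mem_pointsIn]
      constructor
      · intro h
        exact ⟨mk F4 ⟨w, h⟩ (by simpa [Subtype.ext_iff] using hw), rfl⟩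
      · rintro ⟨q, hq⟩
        induction q using Projectivization.ind with
        | h x hx =>
          rw [map_mk] at hq
          obtain ⟨c, hc⟩ := (mk_eq_mk_iff' F4 _ _ _ _).1 hq.symm
          rw [← hc]
          exact W.smul_mem c x.2
  rw [hr, ← Nat.card_coe_set_eq,
    Nat.card_range_of_injective (map_injective _ _), card_of_finrank _ _ h, natCard_F4, bracket4]

theorem ncard_truncSet {i : ℕ} (hWi : Module.finrank F4 W = i + 1)
    (hW : ∀ w ∈ W, w 0 = 0) (hA : ∀ w ∈ A, w 0 = 1) :
    (truncSet W A).ncard = bracket4 i + A.ncard := by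
  have hA0 : ∀ w ∈ A, w ≠ 0 := by
    rintro w hw rfl
    simpa using hA _ hw
  rw [truncSet, Set.ncard_union_eq, ncard_pointsIn hWi]
  · congr 1
    symm
    refine Set.ncard_congr (fun w hw => mk F4 w (hA0 w hw)) (fun w hw => ⟨w, hA0 w hw, hw, rfl⟩)
      (fun u v hu hv h => eq_of_mk_eq_mk h (hA u hu) (hA v hv)) ?_
    rintro _ ⟨w, hw, hwA, rfl⟩
    exact ⟨w, hwA, rfl⟩
  · rw [Set.disjoint_left]
    rintro _ hp ⟨w, hw, hwA, rfl⟩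
    rw [mk_mem_pointsIn] at hp
    exact one_ne_zero ((hA w hwA).symm.trans (hW w hp))

end Truncation

/-! ### Six parallel layers over a hyperoval -/

/-- The embedding of `F4^n` as the hyperplane `x 0 = 0` of `F4^(n+1)`. -/
noncomputable def consZero (n : ℕ) : (Fin n → F4) →ₗ[F4] (Fin (n + 1) → F4) where
  toFun x := Fin.cons 0 x
  map_add' x y := by ext i; refine Fin.cases ?_ (fun j => ?_) i <;> simp
  map_smul' c x := by ext i; refine Fin.cases ?_ (fun j => ?_) i <;> simp

theorem consZero_injective (n : ℕ) : Function.Injective (consZero n) :=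
  Fin.cons_right_injective (α := fun _ => F4) 0

theorem mem_range_consZero {n : ℕ} (w : Fin (n + 1) → F4) :
    w ∈ LinearMap.range (consZero n) ↔ w 0 = 0 := by
  constructor
  · rintro ⟨x, rfl⟩
    rfl
  · intro h
    exact ⟨Fin.tail w, by rw [← Fin.cons_self_tail w, h]; rfl⟩

/-- The subspace of `F4^(m+3)` where the first three coordinates vanish. -/
noncomputable def axis (m : ℕ) : Submodule F4 (Fin (m + 2 + 1) → F4) :=
  LinearMap.range (consZero (m + 2) ∘ₗ consZero (m + 1) ∘ₗ consZero m)

theorem finrank_axis (m : ℕ) : Module.finrank F4 (axis m) = m := by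
  rw [axis, LinearMap.finrank_range_of_inj, Module.finrank_fin_fun]
  exact (consZero_injective _).comp ((consZero_injective _).comp (consZero_injective _))

theorem mem_axis {m : ℕ} (w : Fin (m + 2 + 1) → F4) :
    w ∈ axis m ↔ w 0 = 0 ∧ (w 1, w 2) = 0 := by
  rw [Prod.mk_eq_zero]
  constructor
  · rintro ⟨x, rfl⟩
    exact ⟨rfl, rfl, rfl⟩
  · rintro ⟨h0, h1, h2⟩
    refine ⟨Fin.tail (Fin.tail (Fin.tail w)), ?_⟩
    ext i
    refine Fin.cases h0.symm (Fin.cases h1.symm (Fin.cases h2.symm fun j => rfl)) i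

/-- The affine set whose layer over the `j`-th point of the hyperoval is `a j`. -/
def layers (ω : F4) {m : ℕ} (a : Fin 6 → Set (Fin m → F4)) : Set (Fin (m + 2 + 1) → F4) :=
  {w | w 0 = 1 ∧ ∃ j, (w 1, w 2) = hyperoval ω j ∧ Fin.tail (Fin.tail (Fin.tail w)) ∈ a j}

section Layers

variable {ω : F4} {m : ℕ} {a : Fin 6 → Set (Fin m → F4)}

theorem ncard_layers (hω : ω ^ 2 + ω + 1 = 0) : (layers ω a).ncard = ∑ j, (a j).ncard := by
  let f : (Σ j, a j) → (Fin (m + 2 + 1) → F4) := fun p =>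
    Fin.cons 1 (Fin.cons (hyperoval ω p.1).1 (Fin.cons (hyperoval ω p.1).2 p.2.1))
  have hf : Function.Injective f := by
    rintro ⟨i, x, hx⟩ ⟨j, y, hy⟩ h
    obtain ⟨-, h⟩ := Fin.cons_inj.1 h
    obtain ⟨h1, h⟩ := Fin.cons_inj.1 h
    obtain ⟨h2, h3⟩ := Fin.cons_inj.1 h
    obtain rfl := hyperoval_injective hω (Prod.ext h1 h2)
    obtain rfl : x = y := h3
    rfl
  have hr : layers ω a = Set.range f := by
    ext w
    constructor
    · rintro ⟨h0, j, hj, hw⟩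
      obtain ⟨h1, h2⟩ := Prod.ext_iff.1 hj
      refine ⟨⟨j, _, hw⟩, ?_⟩
      ext i
      refine Fin.cases h0.symm (Fin.cases h1.symm (Fin.cases h2.symm fun j => rfl)) i
    · rintro ⟨⟨j, x, hx⟩, rfl⟩
      exact ⟨rfl, j, rfl, hx⟩
  rw [hr, ← Nat.card_coe_set_eq, Nat.card_range_of_injective hf, Nat.card_sigma]
  rfl

theorem legalTrunc_layers (hω : ω ^ 2 + ω + 1 = 0) (ha : ∀ j, NoTwoSecant ω (a j)) :
    LegalTrunc (truncSet (axis m) (layers ω a)) := by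
  have h2 := F4.two_eq_zero
  refine legalTrunc_truncSet hω (fun w hw => ((mem_axis w).1 hw).1) (fun w hw => hw.1) ?_ ?_
  · rintro u v hu hv ⟨-, i, hi, -⟩ ⟨-, j, hj, -⟩ ⟨-, k, hk, -⟩
    refine (mem_axis v).2 ⟨hv, ?_⟩
    have h := hyperoval_collinear hω (i := i) (j := j) (k := k) (by
      rw [← hi, ← hj, ← hk]; ext <;> simp <;> grind)
    rw [← hi, ← hj] at h
    simp only [Pi.add_apply, Pi.smul_apply, smul_eq_mul, Prod.mk.injEq, Prod.mk_eq_zero] at h ⊢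
    constructor <;> grind
  · rintro u v hu hv huv ⟨-, i, hi, hi'⟩ ⟨-, j, hj, hj'⟩
    have huv := ((mem_axis _).1 huv).2
    simp only [Pi.add_apply, Pi.smul_apply, smul_eq_mul, Prod.mk_eq_zero] at huv hi hj
    have h1 : v 1 = u 1 := by grind
    have h3 : v 2 = u 2 := by grind
    have hui : (u 1, u 2) = hyperoval ω i := by
      rw [← hi, h1, h3]; ext <;> simp <;> grind
    have huj : (u 1, u 2) = hyperoval ω j := by
      rw [← hj, h1, h3]; ext <;> simp <;> grind
    obtain rfl := hyperoval_injective hω (hui.symm.trans huj)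
    exact (ha i _ _ hi' hj').imp (⟨hu, i, hui, ·⟩) (⟨hv, i, by rw [h1, h3, hui], ·⟩)

end Layers

/-- The whole interval is obtained with a removed subspace of codimension two in `H`. -/
theorem mem_TT_of_le (k N : ℕ) (hN : N ≤ 6 * 4 ^ (k + 1)) : bracket4 k + N ∈ TT (k + 3) k := by
  obtain ⟨ω, hω⟩ := F4.exists_cubeRoot
  obtain ⟨a, ha, hs⟩ := exists_six_noTwoSecant hω (k + 1) N hN
  have hW : axis (k + 1) ≤ LinearMap.range (consZero (k + 3)) := fun w hw =>
    (mem_range_consZero w).2 ((mem_axis w).1 hw).1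
  refine ⟨truncSet (axis (k + 1)) (layers ω a), legalTrunc_layers hω ha, ?_,
    LinearMap.range (consZero (k + 3)), axis (k + 1), ?_, finrank_axis _, hW,
    truncSet_inter_pointsIn mem_range_consZero hW fun w hw => hw.1⟩
  · rw [ncard_truncSet (finrank_axis (k + 1)) (fun w hw => ((mem_axis w).1 hw).1)
      (fun w hw => hw.1), ncard_layers hω, hs]
  · rw [LinearMap.finrank_range_of_inj (consZero_injective _), Module.finrank_fin_fun]

/-- High values: for every `d ≥ 3`, every integer `n` in the interval
`[[d-3]₄, [d-1]₄ + 1]` belongs to `T(d) = ⋃_{i=0}^{d-1} T(d,i)`. -/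
theorem statement15 (d : ℕ) (hd : 3 ≤ d) (n : ℕ)
    (h1 : bracket4 (d - 3) ≤ n) (h2 : n ≤ bracket4 (d - 1) + 1) :
    ∃ i : ℕ, i ≤ d - 1 ∧ n ∈ TT d i := by
  obtain ⟨k, rfl⟩ := Nat.exists_eq_add_of_le' hd
  obtain ⟨N, rfl⟩ := Nat.exists_eq_add_of_le h1
  refine ⟨k, by omega, mem_TT_of_le k N ?_⟩
  simp only [bracket4, Nat.add_sub_cancel, show k + 3 - 1 = k + 2 from rfl,
    Finset.sum_range_succ _ (k + 2), Finset.sum_range_succ _ (k + 1), pow_succ] at h2 ⊢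
  have := Nat.one_le_pow k 4 (by norm_num)
  omega
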